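/- Let F_i(x,y) = (1/(2π√(1−t_i²))) ∫_{−∞}^{x} ∫_{−∞}^{y} exp(−(u² − 2 t_i u v + v²)/(2(1−t_i²))) du dv be the standard bivariate normal distribution function with correlation t_i ∈ (−1,1), and let (X_j,Y_j) have the standard bivariate normal distribution with correlation t_j ∈ (−1,1). Then E[F_i(X_j,Y_j)] = ∫_{R²} F_i(x,y) f_j(x,y) dx dy = arcsin((t_i + t_j)/2)/(2π) + 1/4, where f_j is the density of F_j. -/

import Mathlib

open MeasureTheory ProbabilityTheory Real

/-- The standard bivariate normal distribution function with correlation `t`: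
`F_t(x,y) = (1/(2π√(1−t²))) ∫_{−∞}^{x} ∫_{−∞}^{y} exp(−(u² − 2tuv + v²)/(2(1−t²))) du dv`. -/
noncomputable def bvnCDF (t : ℝ) (p : ℝ × ℝ) : ℝ :=
  (1 / (2 * Real.pi * Real.sqrt (1 - t ^ 2))) *
    ∫ u in Set.Iic p.1, ∫ v in Set.Iic p.2,
      Real.exp (-(u ^ 2 - 2 * t * u * v + v ^ 2) / (2 * (1 - t ^ 2)))

/-- The standard bivariate normal density with correlation `t`:
`f_t(x,y) = ∂²F_t/∂x∂y = (1/(2π√(1−t²))) exp(−(x² − 2txy + y²)/(2(1−t²)))`. -/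
noncomputable def bvnPDF (t : ℝ) (p : ℝ × ℝ) : ℝ :=
  (1 / (2 * Real.pi * Real.sqrt (1 - t ^ 2))) *
    Real.exp (-(p.1 ^ 2 - 2 * t * p.1 * p.2 + p.2 ^ 2) / (2 * (1 - t ^ 2)))

open scoped NNReal ENNReal

lemma bvnPDF_nonneg (t : ℝ) (p : ℝ × ℝ) : 0 ≤ bvnPDF t p := by
  unfold bvnPDF
  positivity

lemma measurable_bvnPDF (t : ℝ) : Measurable (bvnPDF t) := by
  unfold bvnPDF
  fun_prop

lemma one_sub_sq_pos_of_mem_Ioo {t : ℝ} (ht : t ∈ Set.Ioo (-1 : ℝ) 1) : 0 < 1 - t ^ 2 := by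
  nlinarith [ht.1, ht.2]

/-- The bivariate normal density is the product of the marginal density of the first coordinate
and the conditional density of the second one. -/
lemma bvnPDF_eq_gaussianPDFReal_mul {t : ℝ} (ht : t ∈ Set.Ioo (-1 : ℝ) 1) (x y : ℝ) :
    bvnPDF t (x, y) =
      gaussianPDFReal 0 1 x * gaussianPDFReal (t * x) (1 - t ^ 2).toNNReal y := by
  have h := one_sub_sq_pos_of_mem_Ioo ht
  have hsqrt : √(2 * π * 1) * √(2 * π * (1 - t ^ 2)) = 2 * π * √(1 - t ^ 2) := by
    rw [Real.sqrt_mul (by positivity : 0 ≤ 2 * π) (1 - t ^ 2), mul_one, ← mul_assoc,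
      Real.mul_self_sqrt (by positivity)]
  rw [bvnPDF, gaussianPDFReal, gaussianPDFReal, Real.coe_toNNReal _ h.le, NNReal.coe_one,
    mul_mul_mul_comm, ← mul_inv, hsqrt, ← Real.exp_add, one_div]
  congr 2
  field_simp
  ring

/-- The standard bivariate normal law with correlation `t`. -/
noncomputable def bvnMeasure (t : ℝ) : Measure (ℝ × ℝ) :=
  volume.withDensity fun p => ENNReal.ofReal (bvnPDF t p)

/-- The linear map sending two independent standard normal variables to a standard bivariate
normal vector with correlation `t`. -/
noncomputable def bvnMap (t : ℝ) : ℝ × ℝ →L[ℝ] ℝ × ℝ :=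
  (ContinuousLinearMap.fst ℝ ℝ ℝ).prod
    (t • ContinuousLinearMap.fst ℝ ℝ ℝ + √(1 - t ^ 2) • ContinuousLinearMap.snd ℝ ℝ ℝ)

@[simp]
lemma bvnMap_apply (t : ℝ) (p : ℝ × ℝ) :
    bvnMap t p = (p.1, t * p.1 + √(1 - t ^ 2) * p.2) := rfl

lemma bvnMeasure_eq_map {t : ℝ} (ht : t ∈ Set.Ioo (-1 : ℝ) 1) :
    bvnMeasure t = ((gaussianReal 0 1).prod (gaussianReal 0 1)).map (bvnMap t) := by
  have h := one_sub_sq_pos_of_mem_Ioo ht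
  have hv : (1 - t ^ 2).toNNReal ≠ 0 := by simpa using h
  refine Measure.ext_of_lintegral _ fun g hg => ?_
  rw [lintegral_map hg (by fun_prop), lintegral_prod _ (by fun_prop), bvnMeasure,
    lintegral_withDensity_eq_lintegral_mul _ (measurable_bvnPDF t).ennreal_ofReal hg,
    Measure.volume_eq_prod,
    lintegral_prod _ ((measurable_bvnPDF t).ennreal_ofReal.mul hg).aemeasurable,
    gaussianReal_of_var_ne_zero 0 one_ne_zero,
    lintegral_withDensity_eq_lintegral_mul _ (measurable_gaussianPDF 0 1)
      (Measurable.lintegral_prod_right' (f := fun p : ℝ × ℝ => g (bvnMap t p)) (by fun_prop)),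
    ← gaussianReal_of_var_ne_zero 0 one_ne_zero]
  refine lintegral_congr fun x => ?_
  have hmap : (gaussianReal 0 1).map (fun y => t * x + √(1 - t ^ 2) * y) =
      gaussianReal (t * x) (1 - t ^ 2).toNNReal := by
    have hcomp : (fun y => t * x + √(1 - t ^ 2) * y) =
        (fun y => t * x + y) ∘ fun y => √(1 - t ^ 2) * y := rfl
    rw [hcomp, ← Measure.map_map (by fun_prop) (by fun_prop), gaussianReal_map_const_mul,
      gaussianReal_map_const_add]
    congr 1
    · simp
    · ext
      simp [Real.sq_sqrt h.le, h.le]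
  have hg' : Measurable fun y => g (x, y) := by fun_prop
  have hinner : ∫⁻ y, g (bvnMap t (x, y)) ∂gaussianReal 0 1 =
      ∫⁻ y, gaussianPDF (t * x) (1 - t ^ 2).toNNReal y * g (x, y) := by
    calc ∫⁻ y, g (bvnMap t (x, y)) ∂gaussianReal 0 1
        = ∫⁻ y, g (x, y) ∂(gaussianReal 0 1).map (fun y => t * x + √(1 - t ^ 2) * y) := by
          rw [lintegral_map hg' (by fun_prop)]
          rfl
      _ = _ := by
          rw [hmap, gaussianReal_of_var_ne_zero _ hv,
            lintegral_withDensity_eq_lintegral_mul _ (measurable_gaussianPDF _ _) hg']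
          rfl
  simp only [Pi.mul_apply]
  rw [hinner, ← lintegral_const_mul _ (by fun_prop)]
  refine lintegral_congr fun y => ?_
  rw [bvnPDF_eq_gaussianPDFReal_mul ht, ENNReal.ofReal_mul (gaussianPDFReal_nonneg _ _ _),
    mul_assoc]
  rfl

lemma isProbabilityMeasure_bvnMeasure {t : ℝ} (ht : t ∈ Set.Ioo (-1 : ℝ) 1) :
    IsProbabilityMeasure (bvnMeasure t) := by
  rw [bvnMeasure_eq_map ht]
  exact Measure.isProbabilityMeasure_map (by fun_prop)

lemma integrable_bvnPDF {t : ℝ} (ht : t ∈ Set.Ioo (-1 : ℝ) 1) : Integrable (bvnPDF t) := by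
  have := isProbabilityMeasure_bvnMeasure ht
  refine ⟨(measurable_bvnPDF t).aestronglyMeasurable, ?_⟩
  rw [hasFiniteIntegral_iff_ofReal (.of_forall (bvnPDF_nonneg t)), ← setLIntegral_univ,
    ← withDensity_apply _ .univ]
  exact measure_lt_top (bvnMeasure t) _

lemma bvnMeasure_real_eq_setIntegral (t : ℝ) {s : Set (ℝ × ℝ)} (hs : MeasurableSet s) :
    (bvnMeasure t).real s = ∫ p in s, bvnPDF t p := by
  rw [measureReal_def, bvnMeasure, withDensity_apply _ hs,
    integral_eq_lintegral_of_nonneg_ae (.of_forall (bvnPDF_nonneg t))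
      (measurable_bvnPDF t).aestronglyMeasurable]

lemma bvnCDF_eq_bvnMeasure_real_Iic {t : ℝ} (ht : t ∈ Set.Ioo (-1 : ℝ) 1) (p : ℝ × ℝ) :
    bvnCDF t p = (bvnMeasure t).real (Set.Iic p) := by
  rw [bvnMeasure_real_eq_setIntegral t measurableSet_Iic, Set.Iic_prod_eq,
    Measure.volume_eq_prod, setIntegral_prod _ (integrable_bvnPDF ht).integrableOn]
  simp_rw [bvnPDF, integral_const_mul]
  rfl

lemma measurable_bvnCDF {t : ℝ} (ht : t ∈ Set.Ioo (-1 : ℝ) 1) : Measurable (bvnCDF t) := by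
  have := isProbabilityMeasure_bvnMeasure ht
  rw [funext (bvnCDF_eq_bvnMeasure_real_Iic ht)]
  exact (measurable_measure_prodMk_left
    (measurableSet_le measurable_snd measurable_fst :
      MeasurableSet {q : (ℝ × ℝ) × (ℝ × ℝ) | q.2 ≤ q.1})).ennreal_toReal

lemma charFunDual_gaussianReal_zero_one (L : StrongDual ℝ ℝ) :
    charFunDual (gaussianReal 0 1) L = Complex.exp (-(L 1 : ℂ) ^ 2 / 2) := by
  rw [charFunDual_eq_charFun_map_one, gaussianReal_map_continuousLinearMap, charFun_gaussianReal]
  have h1 : (L 1 ^ 2).toNNReal = (L 1 ^ 2 : ℝ) := Real.coe_toNNReal _ (sq_nonneg _)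
  simp [neg_div, h1, -Real.coe_toNNReal']

/-- The characteristic function of the standard bivariate normal law with correlation `t`. -/
lemma charFunDual_bvnMeasure {t : ℝ} (ht : t ∈ Set.Ioo (-1 : ℝ) 1) (L : StrongDual ℝ (ℝ × ℝ)) :
    charFunDual (bvnMeasure t) L =
      Complex.exp (-(L (1, 0) ^ 2 + 2 * t * L (1, 0) * L (0, 1) + L (0, 1) ^ 2 : ℝ) / 2) := by
  have h := one_sub_sq_pos_of_mem_Ioo ht
  have hL (x y : ℝ) : L (x, y) = x * L (1, 0) + y * L (0, 1) := by
    have : ((x, y) : ℝ × ℝ) = x • (1, 0) + y • (0, 1) := by simp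
    rw [this, map_add, map_smul, map_smul, smul_eq_mul, smul_eq_mul]
  have hs : ((√(1 - t ^ 2) : ℝ) : ℂ) ^ 2 = 1 - (t : ℂ) ^ 2 := by
    exact_mod_cast Real.sq_sqrt h.le
  rw [bvnMeasure_eq_map ht, charFunDual_map, charFunDual_prod,
    charFunDual_gaussianReal_zero_one, charFunDual_gaussianReal_zero_one, ← Complex.exp_add]
  congr 1
  simp only [ContinuousLinearMap.comp_apply, ContinuousLinearMap.inl_apply,
    ContinuousLinearMap.inr_apply, bvnMap_apply]
  rw [hL 1 (t * 1 + √(1 - t ^ 2) * 0), hL 0 (t * 0 + √(1 - t ^ 2) * 1)]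
  push_cast
  linear_combination (-(L (0, 1) : ℂ) ^ 2 / 2) * hs

/-- The difference of independent standard bivariate normal vectors with correlations `s` and `t`
is `√2` times a standard bivariate normal vector with correlation `(s + t) / 2`. -/
lemma map_sub_bvnMeasure_prod {s t : ℝ} (hs : s ∈ Set.Ioo (-1 : ℝ) 1)
    (ht : t ∈ Set.Ioo (-1 : ℝ) 1) :
    ((bvnMeasure s).prod (bvnMeasure t)).map (fun q => q.2 - q.1) =
      (bvnMeasure ((s + t) / 2)).map (fun p => √2 • p) := by
  have hr : (s + t) / 2 ∈ Set.Ioo (-1 : ℝ) 1 := by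
    constructor <;> linarith [hs.1, hs.2, ht.1, ht.2]
  have := isProbabilityMeasure_bvnMeasure hs
  have := isProbabilityMeasure_bvnMeasure ht
  have := isProbabilityMeasure_bvnMeasure hr
  have h2 : ((√2 : ℝ) : ℂ) ^ 2 = 2 := by exact_mod_cast Real.sq_sqrt zero_le_two
  refine Measure.ext_of_charFunDual (funext fun L => ?_)
  have h₁ := charFunDual_map (μ := (bvnMeasure s).prod (bvnMeasure t))
    (ContinuousLinearMap.snd ℝ (ℝ × ℝ) (ℝ × ℝ) - ContinuousLinearMap.fst ℝ (ℝ × ℝ) (ℝ × ℝ)) L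
  have h₂ := charFunDual_map (μ := bvnMeasure ((s + t) / 2))
    (√2 • ContinuousLinearMap.id ℝ (ℝ × ℝ)) L
  refine h₁.trans (Eq.trans ?_ h₂.symm)
  rw [charFunDual_prod, charFunDual_bvnMeasure hs, charFunDual_bvnMeasure ht,
    charFunDual_bvnMeasure hr, ← Complex.exp_add]
  congr 1
  simp only [ContinuousLinearMap.comp_apply, ContinuousLinearMap.inl_apply,
    ContinuousLinearMap.inr_apply, sub_apply, ContinuousLinearMap.coe_fst',
    ContinuousLinearMap.coe_snd', smul_apply, ContinuousLinearMap.id_apply,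
    zero_sub, sub_zero, map_neg, map_smul, smul_eq_mul]
  push_cast
  linear_combination (((L (1, 0) : ℂ) ^ 2 + (s + t) * L (1, 0) * L (0, 1) + L (0, 1) ^ 2) / 2) * h2

lemma integral_Ioi_mul_exp_neg_sq_div_two : ∫ ρ in Set.Ioi (0 : ℝ), ρ * exp (-ρ ^ 2 / 2) = 1 := by
  have := integral_rpow_mul_exp_neg_mul_rpow (p := 2) (q := 1) (b := 1 / 2)
    (by norm_num) (by norm_num) (by norm_num)
  norm_num [Real.rpow_neg_one] at this
  rw [← this]
  refine setIntegral_congr_fun measurableSet_Ioi fun ρ _ => ?_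
  congr 2
  ring

lemma setOf_cos_nonneg_and_cos_sub_nonneg {φ : ℝ} (hφ : φ ∈ Set.Ioo 0 π) :
    {θ | θ ∈ Set.Ioo (-π) π ∧ 0 ≤ cos θ ∧ 0 ≤ cos (θ - φ)} = Set.Icc (φ - π / 2) (π / 2) := by
  obtain ⟨h0, hπ⟩ := hφ
  ext θ
  simp only [Set.mem_ofPred_eq, Set.mem_Ioo, Set.mem_Icc]
  constructor
  · rintro ⟨⟨h1, h2⟩, hc, hc'⟩
    have hθ : θ ≤ π / 2 := by
      by_contra! hlt
      linarith [cos_neg_of_pi_div_two_lt_of_lt hlt (by linarith)]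
    have hθ' : -(π / 2) ≤ θ := by
      by_contra! hlt
      linarith [cos_neg_of_pi_div_two_lt_of_lt (x := -θ) (by linarith) (by linarith), cos_neg θ]
    refine ⟨?_, hθ⟩
    by_contra! hlt
    linarith [cos_neg_of_pi_div_two_lt_of_lt (x := -(θ - φ)) (by linarith) (by linarith),
      cos_neg (θ - φ)]
  · rintro ⟨h1, h2⟩
    exact ⟨⟨by linarith, by linarith⟩, cos_nonneg_of_mem_Icc ⟨by linarith, by linarith⟩,
      cos_nonneg_of_mem_Icc ⟨by linarith, by linarith⟩⟩

/-- Sheppard's formula for the quadrant probability of a bivariate normal law. -/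
lemma bvnMeasure_real_Ici_zero {t : ℝ} (ht : t ∈ Set.Ioo (-1 : ℝ) 1) :
    (bvnMeasure t).real (Set.Ici 0) = arcsin t / (2 * π) + 1 / 4 := by
  have h0 : (0 : ℝ) ∈ Set.Ioo (-1 : ℝ) 1 := by norm_num
  have hid : bvnMap 0 = ContinuousLinearMap.id ℝ (ℝ × ℝ) := by ext <;> simp
  have hstd : (gaussianReal 0 1).prod (gaussianReal 0 1) = bvnMeasure 0 := by
    rw [bvnMeasure_eq_map h0, hid]
    exact Measure.map_id.symm
  have hφ : arccos t ∈ Set.Ioo 0 π :=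
    ⟨arccos_pos.2 ht.2, (arccos_le_pi t).lt_of_ne fun h => by
      linarith [arccos_eq_pi.1 h, ht.1]⟩
  have hS : MeasurableSet (bvnMap t ⁻¹' Set.Ici 0) :=
    measurableSet_Ici.preimage (bvnMap t).measurable
  have hA : MeasurableSet {θ | 0 ≤ cos θ ∧ 0 ≤ cos (θ - arccos t)} :=
    (isClosed_Ici.preimage continuous_cos).measurableSet.inter
      (isClosed_Ici.preimage (by fun_prop : Continuous fun θ => cos (θ - arccos t))).measurableSet
  rw [bvnMeasure_eq_map ht, map_measureReal_apply (by fun_prop) measurableSet_Ici, hstd,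
    bvnMeasure_real_eq_setIntegral 0 hS, ← integral_indicator hS,
    ← integral_comp_polarCoord_symm, polarCoord_target]
  have key : Set.EqOn
      (fun p : ℝ × ℝ => p.1 • (bvnMap t ⁻¹' Set.Ici 0).indicator (bvnPDF 0) (polarCoord.symm p))
      (fun p => (p.1 * exp (-p.1 ^ 2 / 2)) * (Set.indicator
        {θ | 0 ≤ cos θ ∧ 0 ≤ cos (θ - arccos t)} (fun _ => 1 / (2 * π)) p.2))
      (Set.Ioi 0 ×ˢ Set.Ioo (-π) π) := by
    rintro ⟨ρ, θ⟩ ⟨hρ : 0 < ρ, -⟩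
    have hmem : polarCoord.symm (ρ, θ) ∈ bvnMap t ⁻¹' Set.Ici 0 ↔
        θ ∈ {θ | 0 ≤ cos θ ∧ 0 ≤ cos (θ - arccos t)} := by
      have hlin : t * (ρ * cos θ) + √(1 - t ^ 2) * (ρ * sin θ) = ρ * cos (θ - arccos t) := by
        rw [cos_sub, cos_arccos ht.1.le ht.2.le, sin_arccos]
        ring
      simp [polarCoord_symm_apply, Prod.le_def, hlin, hρ]
    have hpdf : bvnPDF 0 (polarCoord.symm (ρ, θ)) = exp (-ρ ^ 2 / 2) * (1 / (2 * π)) := by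
      rw [polarCoord_symm_apply, bvnPDF, mul_comm]
      congr 1
      · congr 1
        linear_combination (-ρ ^ 2 / 2) * cos_sq_add_sin_sq θ
      · simp
    by_cases h : θ ∈ {θ | 0 ≤ cos θ ∧ 0 ≤ cos (θ - arccos t)}
    · simp only [Set.indicator_of_mem h, Set.indicator_of_mem (hmem.2 h), hpdf, smul_eq_mul,
        mul_assoc]
    · simp only [Set.indicator_of_notMem h, Set.indicator_of_notMem (mt hmem.1 h), smul_zero,
        mul_zero]
  rw [setIntegral_congr_fun (measurableSet_Ioi.prod measurableSet_Ioo) key,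
    Measure.volume_eq_prod, setIntegral_prod_mul (fun ρ : ℝ => ρ * exp (-ρ ^ 2 / 2)),
    integral_Ioi_mul_exp_neg_sq_div_two, setIntegral_indicator hA, setIntegral_const]
  have hset : Set.Ioo (-π) π ∩ {θ | 0 ≤ cos θ ∧ 0 ≤ cos (θ - arccos t)} =
      Set.Icc (arccos t - π / 2) (π / 2) := setOf_cos_nonneg_and_cos_sub_nonneg hφ
  rw [hset, Real.volume_real_Icc_of_le (by linarith [hφ.2]), arccos, smul_eq_mul]
  field_simp
  ring

lemma integral_bvnMeasure (t : ℝ) (g : ℝ × ℝ → ℝ) :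
    ∫ p, g p ∂bvnMeasure t = ∫ p, g p * bvnPDF t p := by
  rw [bvnMeasure, integral_withDensity_eq_integral_toReal_smul
    (measurable_bvnPDF t).ennreal_ofReal (.of_forall fun _ => ENNReal.ofReal_lt_top)]
  simp_rw [ENNReal.toReal_ofReal (bvnPDF_nonneg t _), smul_eq_mul, mul_comm]

lemma integral_bvnCDF_bvnMeasure {s t : ℝ} (hs : s ∈ Set.Ioo (-1 : ℝ) 1)
    (ht : t ∈ Set.Ioo (-1 : ℝ) 1) :
    ∫ p, bvnCDF s p ∂bvnMeasure t = arcsin ((s + t) / 2) / (2 * π) + 1 / 4 := by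
  have hr : (s + t) / 2 ∈ Set.Ioo (-1 : ℝ) 1 := by
    constructor <;> linarith [hs.1, hs.2, ht.1, ht.2]
  have := isProbabilityMeasure_bvnMeasure hs
  have := isProbabilityMeasure_bvnMeasure ht
  have hle : MeasurableSet {q : (ℝ × ℝ) × (ℝ × ℝ) | q.1 ≤ q.2} :=
    measurableSet_le measurable_fst measurable_snd
  have hprod : ∫ p, bvnCDF s p ∂bvnMeasure t =
      ((bvnMeasure s).prod (bvnMeasure t)).real {q | q.1 ≤ q.2} := by
    simp_rw [bvnCDF_eq_bvnMeasure_real_Iic hs, measureReal_def]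
    rw [Measure.prod_apply_symm hle]
    exact integral_toReal (measurable_measure_prodMk_right hle).aemeasurable
      (.of_forall fun _ => measure_lt_top _ _)
  have hsub : {q : (ℝ × ℝ) × (ℝ × ℝ) | q.1 ≤ q.2} = (fun q => q.2 - q.1) ⁻¹' Set.Ici 0 := by
    ext q
    simp
  have hscale : (fun p : ℝ × ℝ => √2 • p) ⁻¹' Set.Ici 0 = Set.Ici 0 := by
    ext p
    simp [Prod.le_def]
  rw [hprod, hsub, ← map_measureReal_apply (by fun_prop) measurableSet_Ici,
    map_sub_bvnMeasure_prod hs ht, map_measureReal_apply (by fun_prop) measurableSet_Ici, hscale,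
    bvnMeasure_real_Ici_zero hr]

/-- If `(X_j, Y_j)` has the standard bivariate normal distribution with
correlation `t_j ∈ (−1,1)` and `F_{t_i}` is the standard bivariate normal distribution
function with correlation `t_i ∈ (−1,1)`, then
`E[F_{t_i}(X_j, Y_j)] = ∫_{ℝ²} F_{t_i}(x,y) f_{t_j}(x,y) dx dy = arcsin((t_i+t_j)/2)/(2π) + 1/4`. -/
theorem expectation_bvnCDF_eq_arcsin
    {Ω : Type*} [MeasureSpace Ω] [IsProbabilityMeasure (ℙ : Measure Ω)]
    (ti tj : ℝ) (hti : ti ∈ Set.Ioo (-1 : ℝ) 1) (htj : tj ∈ Set.Ioo (-1 : ℝ) 1)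
    (X Y : Ω → ℝ)
    (hXY : Measurable fun ω => (X ω, Y ω))
    (hlaw : Measure.map (fun ω => (X ω, Y ω)) ℙ
        = (volume : Measure (ℝ × ℝ)).withDensity fun p => ENNReal.ofReal (bvnPDF tj p)) :
    (∫ ω, bvnCDF ti (X ω, Y ω) ∂ℙ = ∫ p : ℝ × ℝ, bvnCDF ti p * bvnPDF tj p)
    ∧ (∫ p : ℝ × ℝ, bvnCDF ti p * bvnPDF tj p
        = Real.arcsin ((ti + tj) / 2) / (2 * Real.pi) + 1 / 4) := by
  rw [← integral_bvnMeasure]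
  refine ⟨?_, integral_bvnCDF_bvnMeasure hti htj⟩
  rw [bvnMeasure, ← hlaw,
    integral_map hXY.aemeasurable (measurable_bvnCDF hti).aestronglyMeasurable]
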